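/- arXiv:1502.00669 — 9 statements merged into one kernel-verified Lean document; each statement's English description precedes it below -/
import Mathlib

section
/- Let p, q, r, s, t be complex numbers with p ≠ 0 and qt − rs ≠ 0 (so that the associated associativity data is an isomorphism). If p, q, r, s, t satisfy the Fibonacci pentagon equation, then p = 1, rs = q, t = −q, and q² + q − 1 = 0; in particular q = (−1 + √5)/2 or q = (−1 − √5)/2. -/
/-- The Fibonacci pentagon equation: equality of the two 3×3 matrices expressing
the two sides of the pentagon condition on the τ-component of τ^⊗4. -/
def FibPentagon (p q r s t : ℂ) : Prop :=
  (!![p^2*q, p*r*s, p*r*t;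
      p*r*s, q^2 + r*s*t, q*r + r*t^2;
      p*s*t, q*s + s*t^2, r*s + t^3] : Matrix (Fin 3) (Fin 3) ℂ) =
  (!![r*s, q, r*t;
      q, 0, r;
      s*t, s, t^2] : Matrix (Fin 3) (Fin 3) ℂ)

theorem pentagon_solution (p q r s t : ℂ) (hp : p ≠ 0) (hdet : q*t - r*s ≠ 0)
    (hpent : FibPentagon p q r s t) :
    p = 1 ∧ r*s = q ∧ t = -q ∧ q^2 + q - 1 = 0 ∧
      (q = (-1 + Real.sqrt 5)/2 ∨ q = (-1 - Real.sqrt 5)/2) := by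
  have entry := fun i j => congrFun (congrFun hpent i) j
  have h01 : p*r*s = q := entry 0 1
  have h02 : p*r*t = r*t := entry 0 2
  have h11 : q^2 + r*s*t = 0 := entry 1 1
  have h12 : q*r + r*t^2 = r := entry 1 2
  have hrs : r*s ≠ 0 := fun h => hdet (by linear_combination (p*t - 1)*h - t*h01)
  have hr : r ≠ 0 := left_ne_zero_of_mul hrs
  have hq : q ≠ 0 := by
    rw [← h01, mul_assoc]
    exact mul_ne_zero hp hrs
  have ht : t ≠ 0 := by
    rintro rfl
    exact hq (by simpa using h11)
  have hp1 : p = 1 := mul_right_cancel₀ (mul_ne_zero hr ht) (by linear_combination h02)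
  subst hp1
  have hrsq : r*s = q := by linear_combination h01
  have htq : t = -q := mul_left_cancel₀ hq (by linear_combination h11 - t*hrsq)
  have hquad : q^2 + q - 1 = 0 := by
    subst htq
    exact mul_left_cancel₀ hr (by linear_combination h12)
  refine ⟨rfl, hrsq, htq, hquad, ?_⟩
  have h5 : ((Real.sqrt 5 : ℝ) : ℂ)^2 = 5 := by
    exact_mod_cast Real.sq_sqrt (show (0 : ℝ) ≤ 5 by norm_num)
  have hfactor : (q - (-1 + Real.sqrt 5)/2) * (q - (-1 - Real.sqrt 5)/2) = 0 := by
    linear_combination hquad - h5/4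
  exact (mul_eq_zero.mp hfactor).imp sub_eq_zero.mp sub_eq_zero.mp
end

section
/- Let q be a complex number with q² + q − 1 = 0, let t = −q, let p = 1, and let r, s be complex numbers with rs = q. Then p, q, r, s, t satisfy the Fibonacci pentagon equation (in particular the (3,3) entry identity rs + t³ = t² holds). -/
theorem pentagon_of_solution (q r s t p : ℂ) (hq : q^2 + q - 1 = 0)
    (ht : t = -q) (hp : p = 1) (hrs : r*s = q) :
    FibPentagon p q r s t ∧ r*s + t^3 = t^2 := by
  subst ht hp
  have h33 : r * s + (-q) ^ 3 = (-q) ^ 2 := by linear_combination hrs - q * hq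
  refine ⟨?_, h33⟩
  ext i j
  fin_cases i <;> fin_cases j <;> simp
  all_goals grind
end

section
/- Let p, q, r, s, t be complex numbers with p ≠ 0 and qt − rs ≠ 0 satisfying the Fibonacci pentagon equation. Then q ≠ 0, r ≠ 0, s ≠ 0, and t ≠ 0; in particular the matrix ((q,r),(s,t)) is not diagonal, so the natural bases of the two-dimensional τ-component of τ^⊗3 arising from the two parenthesizations (τ⊗τ)⊗τ and τ⊗(τ⊗τ) necessarily disagree. -/
theorem pentagon_entries_nonzero (p q r s t : ℂ) (hp : p ≠ 0)
    (hdet : q*t - r*s ≠ 0) (hpent : FibPentagon p q r s t) :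
    q ≠ 0 ∧ r ≠ 0 ∧ s ≠ 0 ∧ t ≠ 0 := by
  have h₀₀ : p^2*q = r*s := congrFun (congrFun hpent 0) 0
  have h₁₁ : q^2 + r*s*t = 0 := congrFun (congrFun hpent 1) 1
  have hq : q ≠ 0 := by
    rintro rfl
    apply hdet
    rw [← h₀₀]
    ring
  have hrs : r*s ≠ 0 := h₀₀ ▸ mul_ne_zero (pow_ne_zero 2 hp) hq
  refine ⟨hq, left_ne_zero_of_mul hrs, right_ne_zero_of_mul hrs, ?_⟩
  rintro rfl
  exact hq (by simpa using h₁₁)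
end

section
/- Let p, q, r, s, t be complex numbers with p ≠ 0, with q real, such that the matrix ((q,r),(s,t)) is unitary and p, q, r, s, t satisfy the Fibonacci pentagon equation. Then p = 1, q = (√5 − 1)/2, t = −q, and there exists a real number θ such that r = √q · e^{iθ} and s = √q · e^{−iθ}; that is, the unitary associativity isomorphism α_{τ,τ,τ} of the Fibonacci category is determined by the pentagon condition up to the phase θ. -/
open Complex Matrix

theorem unitary_pentagon_determines_alpha (p : ℂ) (q : ℝ) (r s t : ℂ)
    (hp : p ≠ 0)
    (hunit : (!![(q : ℂ), r; s, t] : Matrix (Fin 2) (Fin 2) ℂ) *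
             (!![(q : ℂ), r; s, t] : Matrix (Fin 2) (Fin 2) ℂ)ᴴ = 1)
    (hpent : FibPentagon p (q : ℂ) r s t) :
    p = 1 ∧ q = (Real.sqrt 5 - 1) / 2 ∧ t = -(q : ℂ) ∧
      ∃ θ : ℝ, r = (Real.sqrt q : ℂ) * Complex.exp (θ * I) ∧
               s = (Real.sqrt q : ℂ) * Complex.exp (-θ * I) := by
  have h00 : (q : ℂ) * q + r * star r = 1 := by
    simpa [Matrix.mul_apply] using congrFun₂ hunit 0 0
  have h01 : (q : ℂ) * star s + r * star t = 0 := by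
    simpa [Matrix.mul_apply] using congrFun₂ hunit 0 1
  have h11 : s * star s + t * star t = 1 := by
    simpa [Matrix.mul_apply] using congrFun₂ hunit 1 1
  have hprs : p * r * s = q := congrFun₂ hpent 0 1
  have hprt : p * r * t = r * t := congrFun₂ hpent 0 2
  have hqt : (q : ℂ) ^ 2 + r * s * t = 0 := congrFun₂ hpent 1 1
  have hqr : q * r + r * t ^ 2 = r := congrFun₂ hpent 1 2
  have hq0 : (q : ℂ) ≠ 0 := by
    intro h
    have hr : r ≠ 0 := by rintro rfl; simp [h] at h00
    have hs : s = 0 := by simpa [h, hp, hr] using hprs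
    have ht : t = 0 := by simpa [h, hr] using h01
    simp [hs, ht] at h11
  have hr : r ≠ 0 := by rintro rfl; exact hq0 (by simpa using hprs.symm)
  have ht : t ≠ 0 := by rintro rfl; exact hq0 (by simpa using hqt)
  have hp1 : p = 1 := by
    apply mul_right_cancel₀ (mul_ne_zero hr ht)
    linear_combination hprt
  subst hp1
  have hrs : r * s = q := by simpa using hprs
  have htq : t = -(q : ℂ) := by
    apply mul_left_cancel₀ hq0
    linear_combination hqt - t * hrs
  have hquad : q ^ 2 + q = 1 := by
    have : (q : ℂ) ^ 2 + q = 1 := by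
      apply mul_left_cancel₀ hr
      rw [htq] at hqr
      linear_combination hqr
    exact_mod_cast this
  have hnorm : ‖r‖ ^ 2 = q := by
    have h : (q : ℂ) * q + (‖r‖ : ℂ) ^ 2 = 1 := by
      rw [← Complex.mul_conj']
      exact h00
    have h' : q * q + ‖r‖ ^ 2 = 1 := by exact_mod_cast h
    linarith
  have hq_nonneg : 0 ≤ q := hnorm ▸ sq_nonneg ‖r‖
  have hsqrt : Real.sqrt q = ‖r‖ := by rw [← hnorm, Real.sqrt_sq (norm_nonneg r)]
  have hpolar : r = (Real.sqrt q : ℂ) * Complex.exp (r.arg * I) := by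
    rw [hsqrt, Complex.norm_mul_exp_arg_mul_I]
  refine ⟨rfl, ?_, htq, r.arg, hpolar, ?_⟩
  · have h5 : Real.sqrt 5 = 2 * q + 1 := by
      rw [Real.sqrt_eq_iff_mul_self_eq (by norm_num) (by linarith)]
      linarith
    linarith
  · apply mul_left_cancel₀ hr
    have hsq : (Real.sqrt q : ℂ) * Real.sqrt q = q := by
      exact_mod_cast Real.mul_self_sqrt hq_nonneg
    have hexp : Complex.exp (r.arg * I) * Complex.exp (-r.arg * I) = 1 := by
      rw [← Complex.exp_add]
      simp
    calc r * s = q := hrs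
      _ = ((Real.sqrt q : ℂ) * Complex.exp (r.arg * I)) *
          ((Real.sqrt q : ℂ) * Complex.exp (-r.arg * I)) := by
        rw [mul_mul_mul_comm, hsq, hexp, mul_one]
      _ = r * ((Real.sqrt q : ℂ) * Complex.exp (-r.arg * I)) := by rw [← hpolar]
end

section
/- Let q = (√5 − 1)/2 and let θ be any real number. Then the 2×2 complex matrix ((q, √q · e^{iθ}), (√q · e^{−iθ}, −q)) is unitary, and with p = 1, r = √q · e^{iθ}, s = √q · e^{−iθ}, t = −q, the numbers p, q, r, s, t satisfy the Fibonacci pentagon equation. -/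
open Complex Matrix

/-- The pentagon equation with `p = 1` and `t = -q` follows from `r * s = q` and `q ^ 2 + q = 1`. -/
theorem FibPentagon.of_mul_eq {q r s : ℂ} (hq : q ^ 2 + q = 1) (hrs : r * s = q) :
    FibPentagon 1 q r s (-q) := by
  unfold FibPentagon
  ext i j
  fin_cases i <;> fin_cases j <;> simp <;> grind

theorem mul_conjTranspose_eq_one_of_mul_eq {q r s : ℂ} (hq : q ^ 2 + q = 1) (hrs : r * s = q)
    (hqc : star q = q) (hrc : star r = s) :
    !![q, r; s, -q] * !![q, r; s, -q]ᴴ = 1 := by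
  have hsc : star s = r := by rw [← hrc, star_star]
  have hH : !![q, r; s, -q]ᴴ = !![q, r; s, -q] := by
    ext i j
    fin_cases i <;> fin_cases j <;> simp_all
  rw [hH, Matrix.mul_fin_two, Matrix.one_fin_two]
  ext i j
  fin_cases i <;> fin_cases j <;> simp <;> grind

theorem unitary_pentagon_exists (θ : ℝ) :
    (let q : ℝ := (Real.sqrt 5 - 1) / 2
     let r : ℂ := (Real.sqrt q : ℂ) * Complex.exp (θ * I)
     let s : ℂ := (Real.sqrt q : ℂ) * Complex.exp (-θ * I)
     let t : ℂ := -(q : ℂ)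
     ((!![(q : ℂ), r; s, t] : Matrix (Fin 2) (Fin 2) ℂ) *
        (!![(q : ℂ), r; s, t] : Matrix (Fin 2) (Fin 2) ℂ)ᴴ = 1) ∧
       FibPentagon 1 (q : ℂ) r s t) := by
  intro q r s t
  have hsqrt : Real.sqrt 5 ^ 2 = 5 := Real.sq_sqrt (by norm_num)
  have hq0 : 0 ≤ q := by
    have : 1 ≤ Real.sqrt 5 := Real.one_le_sqrt.mpr (by norm_num)
    simp only [q]
    linarith
  have hq : (q : ℂ) ^ 2 + q = 1 := by
    have : q ^ 2 + q = 1 := by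
      simp only [q]
      linarith
    exact_mod_cast this
  have hrs : r * s = q := by
    simp only [r, s]
    rw [mul_mul_mul_comm, ← Complex.exp_add, ← Complex.ofReal_mul, Real.mul_self_sqrt hq0]
    simp
  have hrc : star r = s := by
    simp [r, s, ← Complex.exp_conj]
  exact ⟨mul_conjTranspose_eq_one_of_mul_eq hq hrs (Complex.conj_ofReal q) hrc,
    FibPentagon.of_mul_eq hq hrs⟩
end

section
/- Let q, r, s, t, b be complex numbers with q ≠ 0, r ≠ 0, s ≠ 0, t = −q, and rs = q. If q, r, s, t, b satisfy the Fibonacci hexagon equation, then b³ = q(1 − b), q + b = b⁴, and 1 + bq + b² = 0. -/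
/-- The Fibonacci hexagon equation: equality of the two 2×2 matrices expressing
the two sides of the hexagon condition on the τ-component of τ^⊗3 (with a = b²). -/
def FibHexagon (q r s t b : ℂ) : Prop :=
  (!![q^2 + b*r*s, (q + b*t)*r;
      (q + b*t)*s, r*s + b*t^2] : Matrix (Fin 2) (Fin 2) ℂ) =
  (!![b^4*q, b^3*r;
      b^3*s, b^2*t] : Matrix (Fin 2) (Fin 2) ℂ)

theorem hexagon_constraints (q r s t b : ℂ) (hq : q ≠ 0) (hr : r ≠ 0) (hs : s ≠ 0)
    (ht : t = -q) (hrs : r*s = q) (hhex : FibHexagon q r s t b) :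
    b^3 = q*(1 - b) ∧ q + b = b^4 ∧ 1 + b*q + b^2 = 0 := by
  subst ht
  have h00 := congrFun (congrFun hhex 0) 0
  have h01 := congrFun (congrFun hhex 0) 1
  have h11 := congrFun (congrFun hhex 1) 1
  simp only [Matrix.of_apply, Matrix.cons_val', Matrix.cons_val_zero, Matrix.cons_val_one,
    Matrix.cons_val_fin_one] at h00 h01 h11
  refine ⟨mul_right_cancel₀ hr ?_, mul_left_cancel₀ hq ?_, mul_left_cancel₀ hq ?_⟩
  · linear_combination -h01
  · linear_combination h00 - b * hrs
  · linear_combination h11 - hrs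
end

section
/- Let b and q be complex numbers satisfying 1 + bq + b² = 0 and b³ = q(1 − b). Then b⁴ − b³ + b² − b + 1 = 0, b⁵ = −1, and b is a primitive 10th root of unity (b¹⁰ = 1 and bᵏ ≠ 1 for all 1 ≤ k < 10). -/
theorem braiding_primitive_tenth_root (b q : ℂ)
    (h1 : 1 + b*q + b^2 = 0) (h2 : b^3 = q*(1 - b)) :
    b^4 - b^3 + b^2 - b + 1 = 0 ∧ b^5 = -1 ∧
      (b^10 = 1 ∧ ∀ k : ℕ, 1 ≤ k → k < 10 → b^k ≠ 1) := by
  have hquartic : b^4 - b^3 + b^2 - b + 1 = 0 := by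
    linear_combination b * h2 + (1 - b) * h1
  have hfive : b^5 = -1 := by linear_combination (b + 1) * hquartic
  refine ⟨hquartic, hfive, by linear_combination (b^5 - 1) * hfive, ?_⟩
  intro k hk hk' hbk
  clear h1 h2
  interval_cases k <;> grind
end

section
/- Let q = (√5 − 1)/2, t = −q, and let r, s be complex numbers with rs = q, r ≠ 0, s ≠ 0. Let b be a complex number such that q, r, s, t, b satisfy the Fibonacci hexagon equation. Then b = exp(3πi/5) or b = exp(−3πi/5), and correspondingly the vacuum-channel braiding eigenvalue a = b² equals exp(6πi/5) or exp(−6πi/5). -/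
open Complex Real

theorem cos_three_pi_div_five : Real.cos (3 * π / 5) = -((√5 - 1) / 2) / 2 := by
  have h5 : √5 ^ 2 = 5 := Real.sq_sqrt (by norm_num)
  rw [show 3 * π / 5 = π - 2 * (π / 5) by ring, Real.cos_pi_sub, Real.cos_two_mul,
    Real.cos_pi_div_five]
  linear_combination (-1 / 8) * h5

theorem exp_three_pi_div_five_add_exp_neg :
    Complex.exp (3*π*I/5) + Complex.exp (-(3*π*I/5)) = -(((√5 - 1) / 2 : ℝ) : ℂ) := by
  have h : (3*π*I/5 : ℂ) = ((3 * π / 5 : ℝ) : ℂ) * I := by push_cast; ring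
  rw [h, ← neg_mul, ← Complex.two_cos, ← Complex.ofReal_cos, cos_three_pi_div_five]
  push_cast
  ring

theorem FibHexagon.sq_add_mul_add_one {q r s b : ℂ} (hq : q ≠ 0) (hrs : r * s = q)
    (h : FibHexagon q r s (-q) b) : b ^ 2 + q * b + 1 = 0 := by
  have h11 : r * s + b * (-q) ^ 2 = b ^ 2 * -q := congrFun (congrFun h 1) 1
  apply mul_left_cancel₀ hq
  linear_combination h11 - hrs

theorem hexagon_determines_braiding (r s t b : ℂ)
    (hrs : r * s = (((Real.sqrt 5 - 1)/2 : ℝ) : ℂ))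
    (hr : r ≠ 0) (hs : s ≠ 0)
    (ht : t = -(((Real.sqrt 5 - 1)/2 : ℝ) : ℂ))
    (hhex : FibHexagon (((Real.sqrt 5 - 1)/2 : ℝ) : ℂ) r s t b) :
    (b = Complex.exp (3*π*I/5) ∧ b^2 = Complex.exp (6*π*I/5)) ∨
    (b = Complex.exp (-(3*π*I/5)) ∧ b^2 = Complex.exp (-(6*π*I/5))) := by
  subst ht
  have hquad := hhex.sq_add_mul_add_one (hrs ▸ mul_ne_zero hr hs) hrs
  have hsum := exp_three_pi_div_five_add_exp_neg
  have hprod : Complex.exp (3*π*I/5) * Complex.exp (-(3*π*I/5)) = 1 := by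
    rw [← Complex.exp_add, add_neg_cancel, Complex.exp_zero]
  have hfactor : (b - Complex.exp (3*π*I/5)) * (b - Complex.exp (-(3*π*I/5))) = 0 := by
    linear_combination hquad - b * hsum + hprod
  refine (mul_eq_zero.mp hfactor).imp (fun h ↦ ?_) (fun h ↦ ?_) <;>
  · have hb := sub_eq_zero.mp h
    refine ⟨hb, ?_⟩
    rw [hb, ← Complex.exp_nat_mul]
    congr 1
    push_cast
    ring
end

section
/- Let q be a complex number with q² + q − 1 = 0 and q ≠ 0, let t = −q, let r, s be complex numbers with rs = q, and let b be a complex number with b² + qb + 1 = 0. Then q, r, s, t, b satisfy the Fibonacci hexagon equation. -/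
theorem hexagon_of_solution (q r s t b : ℂ) (hq : q^2 + q - 1 = 0) (hq0 : q ≠ 0)
    (ht : t = -q) (hrs : r*s = q) (hb : b^2 + q*b + 1 = 0) :
    FibHexagon q r s t b := by
  have hb3 : b^3 = q - q*b := by linear_combination (b - q)*hb + b*hq
  have hb4 : b^4 = b + q := by linear_combination b*hb3 - q*hb + b*hq
  have h00 : q^2 + b*r*s = b^4*q := by linear_combination b*hrs - q*hb4
  have h01 : (q + b*t)*r = b^3*r := by rw [ht, hb3]; ring
  have h10 : (q + b*t)*s = b^3*s := by rw [ht, hb3]; ring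
  have h11 : r*s + b*t^2 = b^2*t := by rw [ht]; linear_combination hrs + q*hb
  rw [FibHexagon, h00, h01, h10, h11]
end
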